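/- arXiv:2402.04348 — 2 statements merged into one kernel-verified Lean document; each statement's English description precedes it below -/
import Mathlib

section
/- There exist constants C > 0, c > 0, and c' > 0 such that for every integer n ≥ 1 and every x ∈ ℝ with |x| ≤ C n^{1/2}(1 + c/n), one has K_n(x,x) = Σ_{j=0}^{n−1} ψ_j(x)² ≥ c' √n. -/
open MeasureTheory Filter ENNReal ProbabilityTheory

noncomputable def psiH (k : ℕ) (x : ℝ) : ℝ :=
  (Real.sqrt Real.pi * 2 ^ k * (Nat.factorial k : ℝ)) ^ (-(1 : ℝ) / 2) * (-1 : ℝ) ^ k *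
    Real.exp (x ^ 2 / 2) * iteratedDeriv k (fun t : ℝ => Real.exp (-t ^ 2)) x

noncomputable def PiH (n : ℕ) : Submodule ℝ (ℝ → ℝ) :=
  Submodule.span ℝ {f : ℝ → ℝ | ∃ k, k < n ∧ f = psiH k}

noncomputable def degApproxH (p : ℝ≥0∞) (n : ℕ) (f : ℝ → ℝ) : ℝ≥0∞ :=
  ⨅ (P : ℝ → ℝ) (_ : P ∈ PiH n), eLpNorm (fun x => f x - P x) p volume

noncomputable def fourierT (f : ℝ → ℝ) (ω : ℝ) : ℂ :=
  (Real.sqrt (2 * Real.pi) : ℂ)⁻¹ * ∫ t : ℝ, (f t : ℂ) * Complex.exp (-(Complex.I * ω * t))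

def SMZ (m : ℕ) (c₁ c₂ c₃ c₄ : ℝ) (ν : Measure ℝ) : Prop :=
  (∀ P ∈ PiH m,
      ENNReal.ofReal c₁ * (∫⁻ t : ℝ, ENNReal.ofReal (P t ^ 2)) ≤ (∫⁻ t, ENNReal.ofReal (P t ^ 2) ∂ν) ∧
      (∫⁻ t, ENNReal.ofReal (P t ^ 2) ∂ν) ≤ ENNReal.ofReal c₂ * (∫⁻ t : ℝ, ENNReal.ofReal (P t ^ 2))) ∧
  ENNReal.ofReal (c₃ * Real.sqrt m) ≤ ν Set.univ ∧ ν Set.univ ≤ ENNReal.ofReal (c₄ * Real.sqrt m)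

noncomputable def gH (k : ℕ) : ℝ → ℝ := iteratedDeriv k (fun t : ℝ => Real.exp (-t ^ 2))

noncomputable def nH (k : ℕ) : ℝ := (Real.sqrt Real.pi * 2 ^ k * (Nat.factorial k : ℝ))⁻¹

noncomputable def sH (n : ℕ) (x : ℝ) : ℝ :=
  ∑ k ∈ Finset.range n, nH k * Real.exp (x ^ 2) * gH k x ^ 2

theorem nH_pos (k : ℕ) : 0 < nH k := by unfold nH; positivity

theorem nH_succ (k : ℕ) : nH k = 2 * (k + 1) * nH (k + 1) := by
  unfold nH
  rw [Nat.factorial_succ]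
  push_cast
  have : 0 < Real.sqrt Real.pi := by positivity
  field_simp
  ring

theorem psiH_sq (k : ℕ) (x : ℝ) : psiH k x ^ 2 = nH k * Real.exp (x ^ 2) * gH k x ^ 2 := by
  unfold psiH
  change (_ * _ * _ * gH k x) ^ 2 = _
  have hpos : 0 ≤ Real.sqrt Real.pi * 2 ^ k * (Nat.factorial k : ℝ) := by positivity
  have h1 : ((Real.sqrt Real.pi * 2 ^ k * (Nat.factorial k : ℝ)) ^ (-(1 : ℝ) / 2)) ^ 2 = nH k := by
    rw [← Real.rpow_natCast, ← Real.rpow_mul hpos]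
    norm_num
    rw [Real.rpow_neg_one, nH]
    try simp [mul_inv]
  have h2 : (Real.exp (x ^ 2 / 2)) ^ 2 = Real.exp (x ^ 2) := by
    rw [← Real.exp_nat_mul]; congr 1; push_cast; ring
  have h3 : ((-1 : ℝ) ^ k) ^ 2 = 1 := by rw [← pow_mul, mul_comm, pow_mul]; simp
  rw [mul_pow, mul_pow, mul_pow, h1, h2, h3]; ring

theorem gH_deriv (k : ℕ) (x : ℝ) : HasDerivAt (gH k) (gH (k + 1) x) x := by
  have hc : ContDiff ℝ (⊤ : ℕ∞) (fun t : ℝ => Real.exp (-t ^ 2)) := by fun_prop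
  have hd : Differentiable ℝ (gH k) :=
    hc.differentiable_iteratedDeriv k (by exact_mod_cast WithTop.coe_lt_top k)
  have := (hd x).hasDerivAt
  rwa [gH, ← iteratedDeriv_succ] at this

theorem gH_zero (x : ℝ) : gH 0 x = Real.exp (-x ^ 2) := by simp [gH]

theorem gH_one (x : ℝ) : gH 1 x = -2 * x * gH 0 x := by
  have h1 := gH_deriv 0 x
  have h2 : HasDerivAt (gH 0) (Real.exp (-x ^ 2) * (-(2 * x))) x := by
    have h : HasDerivAt (fun t : ℝ => -t ^ 2) (-(2 * x)) x := by
      exact (hasDerivAt_pow 2 x).neg.congr_deriv (by simp)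
    have := h.exp
    simpa [gH] using this
  rw [gH_zero, h1.unique h2]; ring

theorem gH_rec (k : ℕ) : ∀ x, gH (k + 2) x = -2 * x * gH (k + 1) x - 2 * (k + 1) * gH k x := by
  induction k with
  | zero =>
    intro x
    have h1 := gH_deriv 1 x
    have h2 : HasDerivAt (gH 1) (-2 * gH 0 x + -2 * x * gH 1 x) x := by
      have : gH 1 = fun x => -2 * x * gH 0 x := funext gH_one
      rw [this]
      have h := ((hasDerivAt_id x).const_mul (-2)).mul (gH_deriv 0 x)
      exact h.congr_deriv (by simp [gH_one])
    have := h1.unique h2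
    norm_num at this ⊢
    linarith
  | succ k ih =>
    intro x
    have h1 := gH_deriv (k + 2) x
    have h2 : HasDerivAt (gH (k + 2)) (-2 * gH (k + 1) x + -2 * x * gH (k + 2) x
        - 2 * (k + 1) * gH (k + 1) x) x := by
      have : gH (k + 2) = fun x => -2 * x * gH (k + 1) x - 2 * (k + 1) * gH k x := funext ih
      rw [this]
      have h := (((hasDerivAt_id x).const_mul (-2)).mul (gH_deriv (k + 1) x)).sub
        ((gH_deriv k x).const_mul (2 * ((k : ℝ) + 1)))
      refine h.congr_deriv ?_
      rw [show k + 1 + 1 = k + 2 by ring, ih]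
      simp
    have := h1.unique h2
    push_cast
    rw [show k + 1 + 2 = k + 2 + 1 by ring, this, show k + 1 + 1 = k + 2 by ring]
    ring

theorem sH_formula (n : ℕ) (x : ℝ) : sH (n + 1) x = nH n * Real.exp (x ^ 2) *
    (gH (n + 1) x ^ 2 / 2 + (n + 1) * gH n x ^ 2 + x * gH n x * gH (n + 1) x) := by
  induction n with
  | zero => simp [sH, gH_one]; left; ring
  | succ n ih =>
    rw [sH, Finset.sum_range_succ, ← sH, ih, nH_succ n, gH_rec n]
    push_cast
    ring

theorem sH_deriv (n : ℕ) (x : ℝ) : HasDerivAt (sH (n + 1))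
    (nH n * Real.exp (x ^ 2) * (gH n x * gH (n + 1) x)) x := by
  have key (k : ℕ) : HasDerivAt (fun x => nH k * Real.exp (x ^ 2) * gH k x ^ 2)
      (nH k * Real.exp (x ^ 2) * (2 * x * gH k x ^ 2 + 2 * gH k x * gH (k + 1) x)) x := by
    have h0 : HasDerivAt (fun x : ℝ => x ^ 2) (2 * x) x := by simpa using hasDerivAt_pow 2 x
    have h := (h0.exp.const_mul (nH k)).mul ((gH_deriv k x).pow 2)
    refine HasDerivAt.congr_deriv h ?_
    simp
    ring
  induction n with
  | zero =>
    have : sH (0 + 1) = fun x => nH 0 * Real.exp (x ^ 2) * gH 0 x ^ 2 := by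
      funext y; simp [sH]
    rw [this]
    refine (key 0).congr_deriv ?_
    rw [zero_add, gH_one]; ring
  | succ n ih =>
    have : sH (n + 1 + 1) = fun x => sH (n + 1) x +
        nH (n + 1) * Real.exp (x ^ 2) * gH (n + 1) x ^ 2 := by
      funext y; rw [sH, Finset.sum_range_succ, ← sH]
    rw [this]
    refine (ih.add (key (n + 1))).congr_deriv ?_
    rw [nH_succ n, show n + 1 + 1 = n + 2 by ring, gH_rec n]; ring

theorem sH_deriv_bound (n : ℕ) (x l : ℝ) (hl : 0 < l) (hl2 : 2 * l ^ 2 = n + 1) (hx : |x| ≤ l) :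
    |l * (nH n * Real.exp (x ^ 2) * (gH n x * gH (n + 1) x))| ≤ sH (n + 1) x := by
  rw [sH_formula]
  have hp : 0 < nH n * Real.exp (x ^ 2) := mul_pos (nH_pos n) (Real.exp_pos _)
  rw [show l * (nH n * Real.exp (x ^ 2) * (gH n x * gH (n + 1) x)) =
    nH n * Real.exp (x ^ 2) * (l * (gH n x * gH (n + 1) x)) by ring, abs_mul, abs_of_pos hp]
  refine mul_le_mul_of_nonneg_left ?_ hp.le
  rw [← hl2]
  generalize gH n x = a
  generalize gH (n + 1) x = b
  have h1 : |x * a * b| ≤ l * |a * b| := by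
    rw [mul_assoc, abs_mul]; exact mul_le_mul_of_nonneg_right hx (abs_nonneg _)
  have h2 := (abs_le.mp h1).1
  have h3 : 2 * (l * |a * b|) ≤ b ^ 2 / 2 + 2 * l ^ 2 * a ^ 2 := by
    rw [abs_mul]
    nlinarith [sq_nonneg (|b| - 2 * l * |a|), sq_abs a, sq_abs b]
  rw [abs_mul, abs_of_pos hl]
  linarith

theorem sH_lower (n : ℕ) (x l : ℝ) (hl : 0 < l) (hl2 : 2 * l ^ 2 = n + 1) (hx : |x| ≤ l) :
    sH (n + 1) 0 * Real.exp (-1) ≤ sH (n + 1) x := by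
  have hE (s : ℝ) (y : ℝ) : HasDerivAt (fun y => sH (n + 1) y * Real.exp (s * (y / l)))
      (nH n * Real.exp (y ^ 2) * (gH n y * gH (n + 1) y) * Real.exp (s * (y / l)) +
        sH (n + 1) y * (Real.exp (s * (y / l)) * (s / l))) y := by
    have h0 : HasDerivAt (fun y : ℝ => s * (y / l)) (s / l) y := by
      have := ((hasDerivAt_id y).div_const l).const_mul s
      refine this.congr_deriv ?_
      ring
    exact (sH_deriv n y).mul h0.exp
  have hs0 (y : ℝ) : 0 ≤ sH (n + 1) y := by
    unfold sH
    exact Finset.sum_nonneg fun k _ => mul_nonneg (mul_nonneg (nH_pos k).le (Real.exp_pos _).le)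
      (sq_nonneg _)
  have hb := fun y hy => abs_le.mp (sH_deriv_bound n y l hl hl2 hy)
  obtain ⟨hx1, hx2⟩ := abs_le.mp hx
  have main : ∀ s : ℝ, sH (n + 1) 0 ≤ sH (n + 1) x * Real.exp (s * (x / l)) → s * (x / l) ≤ 1 →
      sH (n + 1) 0 * Real.exp (-1) ≤ sH (n + 1) x := by
    intro s h1 h2
    have h3 : sH (n + 1) 0 ≤ sH (n + 1) x * Real.exp 1 :=
      h1.trans (mul_le_mul_of_nonneg_left (Real.exp_le_exp.mpr h2) (hs0 x))
    calc _ ≤ sH (n + 1) x * Real.exp 1 * Real.exp (-1) :=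
          mul_le_mul_of_nonneg_right h3 (Real.exp_pos _).le
      _ = sH (n + 1) x := by rw [mul_assoc, ← Real.exp_add]; simp
  rcases le_total 0 x with h0 | h0
  · refine main 1 ?_ (by rw [one_mul, div_le_one hl]; exact hx2)
    have hm : MonotoneOn (fun y => sH (n + 1) y * Real.exp (1 * (y / l))) (Set.Icc (-l) l) := by
      refine monotoneOn_of_deriv_nonneg (convex_Icc _ _)
        (fun y _ => (hE 1 y).continuousAt.continuousWithinAt)
        (fun y _ => (hE 1 y).differentiableAt.differentiableWithinAt) ?_
      intro y hy
      rw [interior_Icc] at hy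
      rw [(hE 1 y).deriv]
      have := (hb y (abs_le.mpr ⟨hy.1.le, hy.2.le⟩)).1
      have h : 0 ≤ (l * (nH n * Real.exp (y ^ 2) * (gH n y * gH (n + 1) y)) + sH (n + 1) y) / l *
        Real.exp (1 * (y / l)) := mul_nonneg (div_nonneg (by linarith) hl.le) (Real.exp_pos _).le
      refine h.trans_eq ?_
      field_simp
    have := hm (a := 0) (b := x) ⟨by linarith, hl.le⟩ ⟨hx1, hx2⟩ h0
    simpa using this
  · refine main (-1) ?_ (by rw [neg_one_mul, ← neg_div, div_le_one hl]; linarith)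
    have hm : AntitoneOn (fun y => sH (n + 1) y * Real.exp (-1 * (y / l))) (Set.Icc (-l) l) := by
      refine antitoneOn_of_deriv_nonpos (convex_Icc _ _)
        (fun y _ => (hE (-1) y).continuousAt.continuousWithinAt)
        (fun y _ => (hE (-1) y).differentiableAt.differentiableWithinAt) ?_
      intro y hy
      rw [interior_Icc] at hy
      rw [(hE (-1) y).deriv]
      have := (hb y (abs_le.mpr ⟨hy.1.le, hy.2.le⟩)).2
      have h : 0 ≤ (sH (n + 1) y - l * (nH n * Real.exp (y ^ 2) * (gH n y * gH (n + 1) y))) / l *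
        Real.exp (-1 * (y / l)) := mul_nonneg (div_nonneg (by linarith) hl.le) (Real.exp_pos _).le
      refine neg_nonneg.mp (h.trans_eq ?_)
      field_simp
      ring
    have := hm (a := x) (b := 0) ⟨hx1, hx2⟩ ⟨by linarith, hl.le⟩ h0
    simpa using this

theorem a_even (j : ℕ) : 1 / Real.pi ≤ (nH (2 * j) * gH (2 * j) 0 ^ 2) ^ 2 * (4 * j + 1) := by
  induction j with
  | zero =>
    simp [gH_zero, nH, Real.sq_sqrt Real.pi_pos.le]
  | succ j ih =>
    refine ih.trans ?_
    rw [show 2 * (j + 1) = 2 * j + 2 by ring, gH_rec (2 * j), nH_succ (2 * j), nH_succ (2 * j + 1)]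
    push_cast
    set A := nH (2 * j + 1 + 1)
    set B := gH (2 * j) 0
    have hj : (0 : ℝ) ≤ j := Nat.cast_nonneg j
    have hk : 0 ≤ (A * B ^ 2) ^ 2 * (16 * (2 * (j : ℝ) + 1) ^ 2) := by positivity
    have e1 : (2 * (2 * (j : ℝ) + 1) * (2 * (2 * j + 1 + 1) * A) * B ^ 2) ^ 2 * (4 * j + 1) =
      (A * B ^ 2) ^ 2 * (16 * (2 * (j : ℝ) + 1) ^ 2) * ((2 * j + 2) ^ 2 * (4 * j + 1)) := by ring
    have e2 : (A * (-2 * 0 * gH (2 * j + 1) 0 - 2 * (2 * (j : ℝ) + 1) * B) ^ 2) ^ 2 *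
        (4 * (j + 1) + 1) =
      (A * B ^ 2) ^ 2 * (16 * (2 * (j : ℝ) + 1) ^ 2) * ((2 * j + 1) ^ 2 * (4 * j + 5)) := by ring
    rw [e1, e2]
    refine mul_le_mul_of_nonneg_left ?_ hk
    nlinarith

theorem sH_zero (n : ℕ) :
    (1 / Real.sqrt (3 * Real.pi)) * Real.sqrt (n + 1 : ℝ) ≤ sH (n + 1) 0 := by
  have hp : ∃ j : ℕ, 2 * j ≤ n + 1 ∧
      ((n : ℝ) + 1) * (nH (2 * j) * gH (2 * j) 0 ^ 2) ≤ sH (n + 1) 0 := by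
    rw [sH_formula]
    have h1 := (nH_pos n).le
    have h2 := mul_nonneg h1 (sq_nonneg (gH (n + 1) 0))
    have h3 := mul_nonneg h1 (sq_nonneg (gH n 0))
    rcases Nat.even_or_odd' n with ⟨j, hj | hj⟩
    · refine ⟨j, by omega, ?_⟩
      rw [← hj]
      simp
      nlinarith
    · refine ⟨j + 1, by omega, ?_⟩
      rw [show 2 * (j + 1) = n + 1 by omega]
      have h4 := nH_succ n
      have h5 : ((n : ℝ) + 1) * (nH (n + 1) * gH (n + 1) 0 ^ 2) = nH n * gH (n + 1) 0 ^ 2 / 2 := by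
        rw [h4]; ring
      rw [h5]
      simp
      nlinarith [mul_nonneg (Nat.cast_nonneg (α := ℝ) n) h3]
  obtain ⟨j, hj, h⟩ := hp
  have ha := a_even j
  set a := nH (2 * j) * gH (2 * j) 0 ^ 2
  have ha0 : 0 ≤ a := mul_nonneg (nH_pos _).le (sq_nonneg _)
  have hj' : 2 * (j : ℝ) ≤ n + 1 := by exact_mod_cast hj
  have hn : (0 : ℝ) ≤ n := Nat.cast_nonneg n
  refine le_trans ?_ h
  rw [one_div_mul_eq_div, ← Real.sqrt_div (by positivity)]
  refine Real.sqrt_le_iff.mpr ⟨by positivity, ?_⟩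
  have hb : 1 / Real.pi ≤ a ^ 2 * (3 * (n + 1)) :=
    ha.trans (mul_le_mul_of_nonneg_left (by linarith) (sq_nonneg a))
  calc ((n : ℝ) + 1) / (3 * Real.pi) = (n + 1) / 3 * (1 / Real.pi) := by
        field_simp
    _ ≤ (n + 1) / 3 * (a ^ 2 * (3 * (n + 1))) := mul_le_mul_of_nonneg_left hb (by positivity)
    _ = _ := by ring

theorem stmt8 :
    ∃ C : ℝ, 0 < C ∧ ∃ c : ℝ, 0 < c ∧ ∃ c' : ℝ, 0 < c' ∧ ∀ (n : ℕ), 1 ≤ n → ∀ x : ℝ,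
      |x| ≤ C * Real.sqrt n * (1 + c / n) →
        c' * Real.sqrt n ≤ ∑ j ∈ Finset.range n, psiH j x ^ 2 := by
  refine ⟨1 / 4, by norm_num, 1, by norm_num, 1 / Real.sqrt (3 * Real.pi) * Real.exp (-1),
    by positivity, ?_⟩
  intro n hn x hx
  obtain ⟨m, rfl⟩ : ∃ m, n = m + 1 := ⟨n - 1, by omega⟩
  have hs : ∑ j ∈ Finset.range (m + 1), psiH j x ^ 2 = sH (m + 1) x :=
    Finset.sum_congr rfl fun k _ => psiH_sq k x
  rw [hs]
  push_cast at hx ⊢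
  have hm : (0 : ℝ) ≤ m := Nat.cast_nonneg m
  have hl : 0 < Real.sqrt (((m : ℝ) + 1) / 2) := Real.sqrt_pos.mpr (by positivity)
  have hx' : |x| ≤ Real.sqrt (((m : ℝ) + 1) / 2) := by
    refine hx.trans (Real.le_sqrt_of_sq_le ?_)
    have h1 : 1 / ((m : ℝ) + 1) ≤ 1 := by rw [div_le_one (by positivity)]; linarith
    have h2 : 0 ≤ 1 / ((m : ℝ) + 1) := by positivity
    rw [mul_pow, mul_pow, Real.sq_sqrt (by positivity)]
    have h3 : (1 + 1 / ((m : ℝ) + 1)) ^ 2 ≤ 4 := by nlinarith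
    nlinarith
  have h := sH_lower m x _ hl (by rw [Real.sq_sqrt (by positivity)]; ring) hx'
  refine le_trans ?_ h
  have := mul_le_mul_of_nonneg_right (sH_zero m) (Real.exp_pos (-1)).le
  linarith
end

section
/- Let c₁, c₂, c₃, c₄ > 0, and let C > 0 be a constant for which the Christoffel lower bound holds (i.e., there is c₀ > 0 with Σ_{j<m} ψ_j(x)² ≥ c₀√m whenever |x| ≤ C√m). Then there exist constants C₁ > 0 and c > 0, depending only on (c₁,c₂,c₃,c₄), C and c₀, such that for every integer m ≥ 1, every positive measure ν ∈ SMZ(m) with constants (c₁,c₂,c₃,c₄), and every x with |x| ≤ C√m, one has ν([x − C₁/√m, x + C₁/√m]) ≤ c · m^{−1/2}. -/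
open MeasureTheory Filter ENNReal ProbabilityTheory

open Polynomial in
noncomputable def hp : ℕ → Polynomial ℝ
  | 0 => 1
  | (k+1) => derivative (hp k) - 2 * X * hp k

lemma hp_zero : hp 0 = 1 := rfl
lemma hp_succ (k : ℕ) : hp (k+1) =
    Polynomial.derivative (hp k) - 2 * Polynomial.X * hp k := rfl

lemma hp_deriv (k : ℕ) : Polynomial.derivative (hp (k+1)) = -2 * ((k : Polynomial ℝ)+1) * hp k := by
  induction k with
  | zero => simp [hp_succ, hp_zero, Polynomial.derivative_ofNat]
  | succ k ih =>
    rw [hp_succ (k+1), Polynomial.derivative_sub, Polynomial.derivative_mul, ih]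
    simp only [Polynomial.derivative_mul, Polynomial.derivative_neg, Polynomial.derivative_ofNat,
      Polynomial.derivative_X, Polynomial.derivative_add, Polynomial.derivative_natCast,
      Polynomial.derivative_one, hp_succ k]
    push_cast
    ring

lemma hasDeriv_gauss (q : Polynomial ℝ) (x : ℝ) :
    HasDerivAt (fun t : ℝ => q.eval t * Real.exp (-t^2))
      ((Polynomial.derivative q - 2 * Polynomial.X * q).eval x * Real.exp (-x^2)) x := by
  have h := (q.hasDerivAt x).mul (((hasDerivAt_id x).pow 2).neg.exp)
  refine h.congr_deriv ?_
  simp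
  ring

lemma hp_iter (k : ℕ) : iteratedDeriv k (fun t : ℝ => Real.exp (-t ^ 2)) =
    fun x => (hp k).eval x * Real.exp (-x^2) := by
  induction k with
  | zero => ext x; simp [hp_zero]
  | succ k ih =>
    rw [iteratedDeriv_succ, ih]
    ext x
    exact (hasDeriv_gauss (hp k) x).deriv

lemma integrable_poly (q : Polynomial ℝ) :
    Integrable (fun x : ℝ => q.eval x * Real.exp (-x^2)) := by
  induction q using Polynomial.induction_on' with
  | add p q hp hq =>
    simp only [Polynomial.eval_add, add_mul]
    exact hp.add hq
  | monomial n a =>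
    have h := (integrable_rpow_mul_exp_neg_mul_sq (b := 1) one_pos (s := n)
      (by have : (0:ℝ) ≤ n := by positivity
          linarith)).const_mul a
    simpa [mul_assoc] using h

lemma integral_deriv_poly (q : Polynomial ℝ) :
    ∫ x : ℝ, (Polynomial.derivative q - 2 * Polynomial.X * q).eval x * Real.exp (-x^2) = 0 :=
  integral_eq_zero_of_hasDerivAt_of_integrable (hasDeriv_gauss q) (integrable_poly _)
    (integrable_poly _)

noncomputable def hI (q : Polynomial ℝ) : ℝ := ∫ x : ℝ, q.eval x * Real.exp (-x^2)

lemma hI_add (p q : Polynomial ℝ) : hI (p + q) = hI p + hI q := by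
  unfold hI
  rw [← integral_add (integrable_poly p) (integrable_poly q)]
  simp [add_mul]

lemma hI_smul (a : ℝ) (q : Polynomial ℝ) : hI (Polynomial.C a * q) = a * hI q := by
  unfold hI
  rw [← integral_const_mul]
  simp [mul_assoc]

lemma hI_step (p q : Polynomial ℝ) :
    hI (p * (Polynomial.derivative q - 2 * Polynomial.X * q)) = - hI (Polynomial.derivative p * q) := by
  have h : hI (p * (Polynomial.derivative q - 2 * Polynomial.X * q) + Polynomial.derivative p * q) = 0 := by
    rw [← integral_deriv_poly (p * q)]
    unfold hI
    congr 1; ext x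
    simp [Polynomial.derivative_mul]
    ring_nf
  rw [hI_add] at h
  linarith

lemma hI_zero (k : ℕ) : hI (hp 0 * hp (k+1)) = 0 := by
  rw [hp_succ, hI_step, hp_zero]
  simp [hI]

lemma hI_succ (j k : ℕ) : hI (hp (j+1) * hp (k+1)) = 2 * ((j:ℝ)+1) * hI (hp j * hp k) := by
  rw [hp_succ k, hI_step, hp_deriv]
  have : -2 * ((j:Polynomial ℝ)+1) * hp j * hp k = Polynomial.C (-2 * ((j:ℝ)+1)) * (hp j * hp k) := by
    simp [show (Polynomial.C 2 : Polynomial ℝ) = 2 from rfl]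
    ring
  rw [this, hI_smul]; ring

lemma hI_ne (j k : ℕ) (h : j ≠ k) : hI (hp j * hp k) = 0 := by
  induction j generalizing k with
  | zero =>
    obtain _ | k := k
    · exact absurd rfl h
    · exact hI_zero k
  | succ j ih =>
    obtain _ | k := k
    · rw [mul_comm]; exact hI_zero j
    · rw [hI_succ, ih k (by omega), mul_zero]

noncomputable def hN (k : ℕ) : ℝ := Real.sqrt Real.pi * 2 ^ k * (Nat.factorial k : ℝ)

lemma hN_pos (k : ℕ) : 0 < hN k := by
  unfold hN
  have := Real.pi_pos
  positivity

lemma hI_eq (k : ℕ) : hI (hp k * hp k) = hN k := by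
  induction k with
  | zero =>
    have := integral_gaussian 1
    simpa [hI, hp_zero, hN] using this
  | succ k ih =>
    rw [hI_succ, ih]
    simp [hN, Nat.factorial_succ]; ring

noncomputable def nc (k : ℕ) : ℝ := (hN k) ^ (-(1 : ℝ) / 2)

lemma nc_eq (k : ℕ) : nc k = (Real.sqrt (hN k))⁻¹ := by
  unfold nc
  rw [Real.sqrt_eq_rpow, ← Real.rpow_neg (hN_pos k).le]
  norm_num

lemma nc_sq (k : ℕ) : nc k * nc k * hN k = 1 := by
  rw [nc_eq]
  have h := Real.mul_self_sqrt (hN_pos k).le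
  have h2 : 0 < Real.sqrt (hN k) := Real.sqrt_pos.2 (hN_pos k)
  field_simp
  nlinarith

lemma nc_succ (k : ℕ) : nc k = nc (k+1) * Real.sqrt (2 * ((k:ℝ)+1)) := by
  have : hN (k+1) = hN k * (2 * ((k:ℝ)+1)) := by
    simp [hN, Nat.factorial_succ]; ring
  rw [nc_eq, nc_eq, this, Real.sqrt_mul (hN_pos k).le]
  have h2 : 0 < Real.sqrt (hN k) := Real.sqrt_pos.2 (hN_pos k)
  have h3 : 0 < Real.sqrt (2 * ((k:ℝ)+1)) := Real.sqrt_pos.2 (by positivity)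
  field_simp

lemma psiH_eq (k : ℕ) (x : ℝ) :
    psiH k x = nc k * (-1)^k * ((hp k).eval x * Real.exp (-x^2/2)) := by
  have : Real.exp (x^2/2) * Real.exp (-x^2) = Real.exp (-x^2/2) := by
    rw [← Real.exp_add]; congr 1; ring
  unfold psiH
  rw [hp_iter, ← this]
  unfold nc hN
  ring

lemma psi_mul (j k : ℕ) (x : ℝ) : psiH j x * psiH k x =
    (nc j * (-1)^j * (nc k * (-1)^k)) * ((hp j * hp k).eval x * Real.exp (-x^2)) := by
  have : Real.exp (-x^2/2) * Real.exp (-x^2/2) = Real.exp (-x^2) := by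
    rw [← Real.exp_add]; congr 1; ring
  rw [psiH_eq, psiH_eq, Polynomial.eval_mul, ← this]; ring

lemma psi_int (j k : ℕ) : Integrable (fun x => psiH j x * psiH k x) := by
  simp_rw [psi_mul]
  exact (integrable_poly _).const_mul _

lemma psi_orth (j k : ℕ) : ∫ x, psiH j x * psiH k x = if j = k then 1 else 0 := by
  simp_rw [psi_mul]
  rw [integral_const_mul]
  change _ * hI (hp j * hp k) = _
  split_ifs with h
  · subst h
    rw [hI_eq]
    have : ((-1:ℝ)^j) * (-1)^j = 1 := by rw [← mul_pow]; simp
    have h2 := nc_sq j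
    linear_combination h2 + nc j * nc j * hN j * this
  · rw [hI_ne j k h, mul_zero]

lemma psi_sq_int (n s : ℕ) (b : ℕ → ℝ) :
    Integrable (fun x => (∑ j ∈ Finset.range n, b j * psiH (j+s) x)^2) ∧
    ∫ x, (∑ j ∈ Finset.range n, b j * psiH (j+s) x)^2 = ∑ j ∈ Finset.range n, b j ^ 2 := by
  have e : (fun x => (∑ j ∈ Finset.range n, b j * psiH (j+s) x)^2) =
      fun x => ∑ j ∈ Finset.range n, ∑ k ∈ Finset.range n,
        (b j * b k) * (psiH (j+s) x * psiH (k+s) x) := by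
    ext x
    rw [sq, Finset.sum_mul_sum]
    refine Finset.sum_congr rfl fun j _ => Finset.sum_congr rfl fun k _ => by ring
  rw [e]
  constructor
  · exact integrable_finsetSum _ fun j _ => integrable_finsetSum _ fun k _ =>
      (psi_int _ _).const_mul _
  · rw [integral_finsetSum _ fun j _ => integrable_finsetSum _ fun k _ =>
      (psi_int _ _).const_mul _]
    refine Finset.sum_congr rfl fun j hj => ?_
    rw [integral_finsetSum _ fun k _ => (psi_int _ _).const_mul _]
    simp_rw [integral_const_mul, psi_orth]
    simp [Finset.mem_range.1 hj, sq]

lemma psi_hasDeriv (k : ℕ) (x : ℝ) : HasDerivAt (psiH k)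
    (Real.sqrt ((k:ℝ)/2) * psiH (k-1) x - Real.sqrt (((k:ℝ)+1)/2) * psiH (k+1) x) x := by
  have hE : HasDerivAt (fun t : ℝ => (hp k).eval t * Real.exp (-t^2/2))
      ((Polynomial.derivative (hp k)).eval x * Real.exp (-x^2/2)
        - x * (hp k).eval x * Real.exp (-x^2/2)) x := by
    have h := ((hp k).hasDerivAt x).mul ((((hasDerivAt_id x).pow 2).neg.div_const 2).exp)
    refine h.congr_deriv ?_
    simp
    ring
  have hf : psiH k = fun t => nc k * (-1)^k * ((hp k).eval t * Real.exp (-t^2/2)) := by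
    ext t; exact psiH_eq k t
  have h2 := hE.const_mul (nc k * (-1)^k)
  rw [hf]
  refine h2.congr_deriv (Eq.symm ?_)
  have hs : ∀ j : ℕ, Real.sqrt (((j:ℝ)+1)/2) = Real.sqrt (2*((j:ℝ)+1)) / 2 := by
    intro j
    rw [show ((j:ℝ)+1)/2 = (2*((j:ℝ)+1)) / 2^2 by ring, Real.sqrt_div (by positivity),
      Real.sqrt_sq (by norm_num)]
  have hp1 : (hp (k+1)).eval x = (Polynomial.derivative (hp k)).eval x - 2 * x * (hp k).eval x := by
    simp [hp_succ]
  rw [hs k, psiH_eq (k+1), hp1, nc_succ k]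
  obtain _ | k := k
  · simp [hp_zero]; ring
  · have hd : (Polynomial.derivative (hp (k+1))).eval x = -2 * ((k:ℝ)+1) * (hp k).eval x := by
      simp [hp_deriv]
    have hx : psiH (k+1-1) x = nc k * (-1)^k * ((hp k).eval x * Real.exp (-x^2/2)) := psiH_eq k x
    rw [hx, hd]
    have h3 := nc_succ (k+1)
    push_cast at h3 ⊢
    rw [hs k, ← h3, nc_succ k]
    have h4 := Real.mul_self_sqrt (show (0:ℝ) ≤ 2*((k:ℝ)+1) by positivity)
    rw [pow_succ (-1:ℝ) (k+1), pow_succ (-1:ℝ) k]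
    linear_combination (1/2) * nc (k+1) * (-1)^k * (hp k).eval x * Real.exp (-x^2/2) * h4
      + (1/2) * (-1)^k * (-2 * ((k:ℝ)+1) * (hp k).eval x - 2*x*(hp (k+1)).eval x) * Real.exp (-x^2/2) * h3

lemma psi_cont (k : ℕ) : Continuous (psiH k) :=
  continuous_iff_continuousAt.2 fun x => (psi_hasDeriv k x).continuousAt

/-- Bernstein inequality plus the Hoelder estimate. -/
lemma holder (n : ℕ) (a : ℕ → ℝ) (x t : ℝ) :
    (∑ j ∈ Finset.range (n+1), a j * psiH j t - ∑ j ∈ Finset.range (n+1), a j * psiH j x)^2 ≤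
      |t - x| * (2 * ((n:ℝ)+1) * ∑ j ∈ Finset.range (n+1), a j ^ 2) := by
  wlog hxt : x < t generalizing x t with H
  · rcases eq_or_lt_of_le (not_lt.1 hxt) with h | h
    · subst h; simp
    · have := H t x h
      rw [abs_sub_comm]
      nlinarith
  set P := fun y => ∑ j ∈ Finset.range (n+1), a j * psiH j y with hP
  set U := fun y => ∑ j ∈ Finset.range n, (a (j+1) * Real.sqrt (((j:ℝ)+1)/2)) * psiH (j+0) y with hU
  set V := fun y => ∑ j ∈ Finset.range (n+1), (a j * Real.sqrt (((j:ℝ)+1)/2)) * psiH (j+1) y with hV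
  have hd : ∀ y, HasDerivAt P (U y - V y) y := by
    intro y
    have h := HasDerivAt.fun_sum (u := Finset.range (n+1)) (A := fun j z => a j * psiH j z)
      (A' := fun j => a j * (Real.sqrt ((j:ℝ)/2) * psiH (j-1) y - Real.sqrt (((j:ℝ)+1)/2) * psiH (j+1) y))
      (x := y) (fun j _ => (psi_hasDeriv j y).const_mul (a j))
    refine h.congr_deriv (Eq.symm ?_)
    simp only [mul_sub, Finset.sum_sub_distrib]
    congr 1
    · rw [Finset.sum_range_succ']
      simp [hU, mul_assoc]
    · simp [hV, mul_assoc]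
  have hUc : Continuous U := continuous_finsetSum _ fun j _ => continuous_const.mul (psi_cont _)
  have hVc : Continuous V := continuous_finsetSum _ fun j _ => continuous_const.mul (psi_cont _)
  have hUVc : Continuous (fun y => U y - V y) := hUc.sub hVc
  obtain ⟨iU, eU⟩ := psi_sq_int n 0 (fun j => a (j+1) * Real.sqrt (((j:ℝ)+1)/2))
  obtain ⟨iV, eV⟩ := psi_sq_int (n+1) 1 (fun j => a j * Real.sqrt (((j:ℝ)+1)/2))
  set S := ∑ j ∈ Finset.range (n+1), a j ^ 2 with hS
  have bU : ∫ y, U y ^ 2 ≤ ((n:ℝ)+1)/2 * S := by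
    rw [eU]
    calc _ ≤ ∑ j ∈ Finset.range n, ((n:ℝ)+1)/2 * a (j+1)^2 := by
          refine Finset.sum_le_sum fun j hj => ?_
          rw [mul_pow, Real.sq_sqrt (by positivity), mul_comm]
          have : (j:ℝ) ≤ n := by exact_mod_cast (Finset.mem_range.1 hj).le
          gcongr
      _ ≤ _ := by
          rw [← Finset.mul_sum, hS, Finset.sum_range_succ']
          gcongr
          nlinarith [sq_nonneg (a 0)]
  have bV : ∫ y, V y ^ 2 ≤ ((n:ℝ)+1)/2 * S := by
    rw [eV, hS, Finset.mul_sum]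
    refine Finset.sum_le_sum fun j hj => ?_
    rw [mul_pow, Real.sq_sqrt (by positivity), mul_comm]
    have : (j:ℝ) ≤ n := by exact_mod_cast Nat.lt_succ_iff.1 (Finset.mem_range.1 hj)
    gcongr
  have iUV : Integrable (fun y => 2 * U y ^ 2 + 2 * V y ^ 2) := (iU.const_mul 2).add (iV.const_mul 2)
  have bI : ∫ y in x..t, (U y - V y)^2 ≤ 2 * ((n:ℝ)+1) * S := by
    calc _ ≤ ∫ y in x..t, (2 * U y ^ 2 + 2 * V y ^ 2) := by
          refine intervalIntegral.integral_mono_on hxt.le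
            ((hUVc.pow 2).intervalIntegrable _ _) iUV.intervalIntegrable ?_
          intro y _
          nlinarith [sq_nonneg (U y + V y)]
      _ ≤ ∫ y, (2 * U y ^ 2 + 2 * V y ^ 2) := by
          rw [intervalIntegral.integral_of_le hxt.le]
          exact setIntegral_le_integral iUV (Eventually.of_forall fun y => by positivity)
      _ ≤ _ := by
          rw [integral_add (iU.const_mul 2) (iV.const_mul 2), integral_const_mul, integral_const_mul]
          linarith
  have hF : ∫ y in x..t, (U y - V y) = P t - P x :=
    intervalIntegral.integral_eq_sub_of_hasDerivAt (fun y _ => hd y) (hUVc.intervalIntegrable _ _)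
  have hpos : 0 < t - x := sub_pos.2 hxt
  set d := P t - P x with hdd
  set b := d / (t - x) with hb
  have hnn : 0 ≤ ∫ y in x..t, (U y - V y - b)^2 :=
    intervalIntegral.integral_nonneg hxt.le fun y _ => sq_nonneg _
  have hexp : ∫ y in x..t, (U y - V y - b)^2 =
      (∫ y in x..t, (U y - V y)^2) - 2 * b * d + b^2 * (t - x) := by
    have e : ∀ y, (U y - V y - b)^2 = (U y - V y)^2 - 2 * b * (U y - V y) + b^2 := fun y => by ring
    simp_rw [e]
    rw [intervalIntegral.integral_add, intervalIntegral.integral_sub,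
      intervalIntegral.integral_const_mul, hF]
    · simp; ring
    all_goals exact Continuous.intervalIntegrable (by fun_prop) _ _
  have hbd : b * (t - x) = d := by rw [hb]; field_simp
  rw [abs_of_pos hpos]
  rw [hexp] at hnn
  have h5 : b * d ≤ 2 * ((n:ℝ)+1) * S := by
    have : b^2 * (t-x) = b * d := by rw [← hbd]; ring
    linarith
  calc d^2 = (t-x) * (b * d) := by rw [← hbd]; ring
    _ ≤ _ := by gcongr

theorem stmt11 (c₁ c₂ c₃ c₄ C c₀ : ℝ) (h₁ : 0 < c₁) (h₂ : 0 < c₂) (h₃ : 0 < c₃) (h₄ : 0 < c₄)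
    (hC : 0 < C) (hc₀ : 0 < c₀)
    (hChrist : ∀ m : ℕ, 1 ≤ m → ∀ x : ℝ, |x| ≤ C * Real.sqrt m →
      c₀ * Real.sqrt m ≤ ∑ j ∈ Finset.range m, psiH j x ^ 2) :
    ∃ C₁ : ℝ, 0 < C₁ ∧ ∃ c : ℝ, 0 < c ∧
      ∀ (m : ℕ), 1 ≤ m → ∀ (ν : Measure ℝ), SMZ m c₁ c₂ c₃ c₄ ν →
      ∀ x : ℝ, |x| ≤ C * Real.sqrt m →
        ν (Set.Icc (x - C₁ / Real.sqrt m) (x + C₁ / Real.sqrt m)) ≤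
          ENNReal.ofReal (c / Real.sqrt m) := by
  refine ⟨c₀ / 8, by positivity, 4 * c₂ / c₀, by positivity, ?_⟩
  intro m hm ν hν x hx
  set K := ∑ j ∈ Finset.range m, psiH j x ^ 2 with hK
  have hKl := hChrist m hm x hx
  have hm0 : (0:ℝ) < m := by exact_mod_cast hm
  have hs : 0 < Real.sqrt m := Real.sqrt_pos.2 hm0
  have hss : Real.sqrt m * Real.sqrt m = m := Real.mul_self_sqrt hm0.le
  have hKpos : 0 < K := lt_of_lt_of_le (by positivity) hKl
  set P : ℝ → ℝ := fun t => ∑ j ∈ Finset.range m, psiH j x * psiH j t with hP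
  have hPm : P ∈ PiH m := by
    have : P = ∑ j ∈ Finset.range m, psiH j x • psiH j := by
      ext t; simp [hP]
    rw [this]
    refine Submodule.sum_mem _ fun j hj => Submodule.smul_mem _ _ (Submodule.subset_span ?_)
    exact ⟨j, Finset.mem_range.1 hj, rfl⟩
  have hub := (hν.1 P hPm).2
  obtain ⟨iP, eP⟩ := psi_sq_int m 0 (fun j => psiH j x)
  replace iP : Integrable (fun t => P t ^ 2) := iP
  have hint : ∫⁻ t : ℝ, ENNReal.ofReal (P t ^ 2) = ENNReal.ofReal K := by
    rw [← ofReal_integral_eq_lintegral_ofReal iP (Eventually.of_forall fun y => by positivity)]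
    congr 1
  have hPx : P x = K := by simp [hP, hK, sq]
  have hlow : ∀ t ∈ Set.Icc (x - c₀ / 8 / Real.sqrt m) (x + c₀ / 8 / Real.sqrt m),
      K^2/4 ≤ P t ^ 2 := by
    intro t ht
    obtain ⟨n, rfl⟩ : ∃ n, m = n + 1 := ⟨m - 1, by omega⟩
    have hh : (P t - P x)^2 ≤ |t - x| * (2 * ((n:ℝ)+1) * K) := holder n (fun j => psiH j x) x t
    have ht2 : |t - x| ≤ c₀ / 8 / Real.sqrt ((n+1:ℕ):ℝ) := by
      rw [abs_le]; constructor <;> linarith [ht.1, ht.2]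
    have h6 : (P t - P x)^2 ≤ (K/2)^2 := by
      calc _ ≤ _ := hh
        _ ≤ c₀ / 8 / Real.sqrt ((n+1:ℕ):ℝ) * (2 * ((n:ℝ)+1) * K) := by gcongr
        _ = (c₀ * Real.sqrt ((n+1:ℕ):ℝ)) * K / 4 := by
          rw [show ((n:ℝ)+1) = Real.sqrt ((n+1:ℕ):ℝ) * Real.sqrt ((n+1:ℕ):ℝ) by
            rw [hss]; push_cast; rfl]
          field_simp
          ring
        _ ≤ K * K / 4 := by gcongr
        _ = _ := by ring
    have h7 := abs_le_of_sq_le_sq' h6 (by positivity)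
    rw [hPx] at h7
    nlinarith [h7.1]
  have hmark : ENNReal.ofReal (K^2/4) *
      ν (Set.Icc (x - c₀ / 8 / Real.sqrt m) (x + c₀ / 8 / Real.sqrt m)) ≤
      ENNReal.ofReal c₂ * ENNReal.ofReal K := by
    rw [← hint]
    refine le_trans ?_ hub
    rw [← setLIntegral_const]
    refine le_trans (setLIntegral_mono' measurableSet_Icc fun t ht => ?_) (setLIntegral_le_lintegral _ _)
    exact ENNReal.ofReal_le_ofReal (hlow t ht)
  rw [← ENNReal.ofReal_mul h₂.le, mul_comm, ← ENNReal.le_div_iff_mul_le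
    (Or.inl (by simpa using by positivity)) (Or.inl ENNReal.ofReal_ne_top),
    ← ENNReal.ofReal_div_of_pos (by positivity)] at hmark
  refine hmark.trans (ENNReal.ofReal_le_ofReal ?_)
  calc c₂ * K / (K^2/4) = 4 * c₂ / K := by field_simp
    _ ≤ 4 * c₂ / (c₀ * Real.sqrt m) := by gcongr
    _ = _ := by field_simp
end
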